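/- Let A be a weighted pushdown system. The following statements are equivalent: (i) there exists an infinite valid path π₁ starting from the initial configuration with LimSupAvg(π₁) > 0; (ii) there exists an infinite valid path π₂ starting from the initial configuration with LimInfAvg(π₂) > 0; (iii) there exists a finite valid path π starting from the initial configuration that contains a good cycle. -/

import Mathlib

open scoped BigOperators

namespace PDS

/-- Stack commands over a stack alphabet `Γ`. -/
inductive Com (Γ : Type) where
  | skip : Com Γ
  | pop : Com Γ
  | push (z : Γ) : Com Γ
  deriving DecidableEq

/-- Action of a stack command on a stack string (top of stack at the head). -/
def Com.apply {Γ : Type} : Com Γ → List Γ → List Γ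
  | .skip, α => α
  | .pop, α => α.tail
  | .push z, α => z :: α

/-- A transition (edge) of a pushdown system. -/
structure Edge (Q Γ : Type) where
  q1 : Q
  top : Γ
  q2 : Q
  com : Com Γ
  deriving DecidableEq

/-- A weighted pushdown system. -/
structure WPS (Q Γ : Type) where
  q0 : Q
  bot : Γ
  E : Set (Edge Q Γ)
  w : Edge Q Γ → ℤ
  no_push_bot : ∀ e ∈ E, e.com ≠ Com.push bot
  no_pop_bot : ∀ e ∈ E, e.top = bot → e.com ≠ Com.pop

variable {Q Γ : Type}

/-- A configuration: stack string (top at head) together with a state. -/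
abbrev Config (Q Γ : Type) := List Γ × Q

/-- A genuine configuration has a nonempty stack string. -/
def IsConfig (c : Config Q Γ) : Prop := c.1 ≠ []

/-- The initial configuration `(⊥, q₀)`. -/
def WPS.start (A : WPS Q Γ) : Config Q Γ := ([A.bot], A.q0)

/-- The configuration obtained by taking the edge `e` from `c`. -/
def next (c : Config Q Γ) (e : Edge Q Γ) : Config Q Γ := (e.com.apply c.1, e.q2)

/-- The edge `e` is enabled at configuration `c`. -/
def WPS.Enabled (A : WPS Q Γ) (c : Config Q Γ) (e : Edge Q Γ) : Prop :=
  e ∈ A.E ∧ c.2 = e.q1 ∧ c.1.head? = some e.top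

/-- Validity of a finite path, given by a start configuration and a list of edges. -/
def WPS.Valid (A : WPS Q Γ) : Config Q Γ → List (Edge Q Γ) → Prop
  | _, [] => True
  | c, e :: es => A.Enabled c e ∧ A.Valid (next c e) es

/-- Last configuration of the finite path `(c, es)`. -/
def endc (c : Config Q Γ) (es : List (Edge Q Γ)) : Config Q Γ := es.foldl next c

/-- The list of configurations along the finite path `(c, es)`. -/
def trace (c : Config Q Γ) (es : List (Edge Q Γ)) : List (Config Q Γ) :=
  List.scanl next c es

/-- Total weight of a finite path. -/
def WPS.wt (A : WPS Q Γ) (es : List (Edge Q Γ)) : ℤ := (es.map A.w).sum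

/-- Stack height of a configuration. -/
def height (c : Config Q Γ) : ℕ := c.1.length

/-- Stack height of a finite path: maximal stack height along it. -/
def SH (c : Config Q Γ) (es : List (Edge Q Γ)) : ℕ :=
  ((trace c es).map height).foldr max 0

/-- Additional stack height of a finite path. -/
def ASH (c : Config Q Γ) (es : List (Edge Q Γ)) : ℕ :=
  SH c es - max (height c) (height (endc c es))

/-- The first configuration of the path is a local minima: its stack string is a
prefix (here: suffix of the list, since the top is at the head) of all stack strings
along the path. -/
def FirstMin (c : Config Q Γ) (es : List (Edge Q Γ)) : Prop :=
  ∀ c' ∈ trace c es, c.1 <:+ c'.1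

/-- The edge sequence obtained from `u ++ p₁ ++ v ++ p₂ ++ x` by repeating `p₁` and
`p₂` each `j` times in place. -/
def pumped (u p₁ v p₂ x : List (Edge Q Γ)) (j : ℕ) : List (Edge Q Γ) :=
  u ++ (List.replicate j p₁).flatten ++ v ++ (List.replicate j p₂).flatten ++ x

/-- `(p₁, p₂)` is a pumpable pair of paths for the path `(c, es)`. -/
def WPS.PumpablePair (A : WPS Q Γ) (c : Config Q Γ) (es p₁ p₂ : List (Edge Q Γ)) : Prop :=
  p₁ ≠ [] ∧ p₂ ≠ [] ∧
    ∃ u v x, es = u ++ p₁ ++ v ++ p₂ ++ x ∧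
      ∀ j : ℕ, A.Valid c (pumped u p₁ v p₂ x j)

/-- The path `(c, es)` has a pumpable pair of paths. -/
def WPS.HasPumpablePair (A : WPS Q Γ) (c : Config Q Γ) (es : List (Edge Q Γ)) : Prop :=
  ∃ p₁ p₂, A.PumpablePair c es p₁ p₂

/-- `(c, es)` is a good cycle. -/
def WPS.GoodCycle (A : WPS Q Γ) (c : Config Q Γ) (es : List (Edge Q Γ)) : Prop :=
  A.Valid c es ∧ 0 < A.wt es ∧ FirstMin c es ∧
    (endc c es).2 = c.2 ∧ (endc c es).1.head? = c.1.head?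

/-- `A` has a good cycle reachable from the configuration `c`. -/
def WPS.ReachableGoodCycleFrom (A : WPS Q Γ) (c : Config Q Γ) : Prop :=
  ∃ es₀ es, A.Valid c es₀ ∧ A.GoodCycle (endc c es₀) es

/-- `A` has a good cycle (at some configuration). -/
def WPS.HasGoodCycle (A : WPS Q Γ) : Prop :=
  ∃ c es, IsConfig c ∧ A.GoodCycle c es

/-- The finite path `(c, es)` contains a good cycle. -/
def ContainsGoodCycle (A : WPS Q Γ) (c : Config Q Γ) (es : List (Edge Q Γ)) : Prop :=
  ∃ es₁ es₂, es = es₁ ++ es₂ ∧ A.GoodCycle (endc c es₁) es₂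

/-- Configurations along an infinite path given by an infinite edge sequence. -/
def confs (c : Config Q Γ) (f : ℕ → Edge Q Γ) : ℕ → Config Q Γ
  | 0 => c
  | n + 1 => next (confs c f n) (f n)

/-- Validity of the infinite path `(c, f)`. -/
def WPS.ValidInf (A : WPS Q Γ) (c : Config Q Γ) (f : ℕ → Edge Q Γ) : Prop :=
  ∀ n, A.Enabled (confs c f n) (f n)

/-- Average weight of the prefix of length `n+1` of an infinite path. -/
noncomputable def avgPref (A : WPS Q Γ) (f : ℕ → Edge Q Γ) (n : ℕ) : ℝ :=
  (∑ i ∈ Finset.range (n + 1), (A.w (f i) : ℝ)) / (n + 1)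

/-- Limit-sup of the averages along an infinite path. -/
noncomputable def LimSupAvg (A : WPS Q Γ) (f : ℕ → Edge Q Γ) : ℝ :=
  Filter.limsup (avgPref A f) Filter.atTop

/-- Limit-inf of the averages along an infinite path. -/
noncomputable def LimInfAvg (A : WPS Q Γ) (f : ℕ → Edge Q Γ) : ℝ :=
  Filter.liminf (avgPref A f) Filter.atTop

/-- An infinite edge sequence is ultimately periodic. -/
def UltPeriodic (f : ℕ → Edge Q Γ) : Prop :=
  ∃ N p : ℕ, 0 < p ∧ ∀ n, N ≤ n → f (n + p) = f n

/-- The infinite path `(c, f)` is stack bounded. -/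
def StackBounded (c : Config Q Γ) (f : ℕ → Edge Q Γ) : Prop :=
  ∃ n : ℕ, ∀ k, height (confs c f k) ≤ n

/-- Non-decreasing path: a valid path whose first configuration is a local minima. -/
def WPS.NonDec (A : WPS Q Γ) (c : Config Q Γ) (es : List (Edge Q Γ)) : Prop :=
  A.Valid c es ∧ FirstMin c es

/-- Summary function, valued in `EReal`: `⊥` means there is no non-decreasing path
from `(⊥γ,q₁)` to `(⊥γ,q₂)`, `⊤` means `ω` (weights unbounded from above), and
otherwise the value is the maximal weight of such a path. -/
noncomputable def WPS.summary (A : WPS Q Γ) (q₁ : Q) (γ : Γ) (q₂ : Q) : EReal :=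
  sSup { x : EReal | ∃ es, A.NonDec ([γ, A.bot], q₁) es ∧
    endc ([γ, A.bot], q₁) es = ([γ, A.bot], q₂) ∧ x = ((A.wt es : ℝ) : EReal) }

/-- Stack height bounded summary function: as `summary` but only over non-decreasing
paths of additional stack height at most `d`. -/
noncomputable def WPS.summaryBdd (A : WPS Q Γ) (d : ℕ) (q₁ : Q) (γ : Γ) (q₂ : Q) : EReal :=
  sSup { x : EReal | ∃ es, A.NonDec ([γ, A.bot], q₁) es ∧
    endc ([γ, A.bot], q₁) es = ([γ, A.bot], q₂) ∧ ASH ([γ, A.bot], q₁) es ≤ d ∧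
    x = ((A.wt es : ℝ) : EReal) }

/-- Edges of the summary graph `Gr(A)` together with their weights in `EReal`
(`⊤` plays the role of `ω`): skip edges weighted by the summary function and push
edges weighted by the corresponding transition weight. -/
def WPS.GrEdge (A : WPS Q Γ) (v₁ v₂ : Q × Γ) (x : EReal) : Prop :=
  (v₁.2 = v₂.2 ∧ A.summary v₁.1 v₁.2 v₂.1 ≠ ⊥ ∧ x = A.summary v₁.1 v₁.2 v₂.1) ∨
  (∃ e ∈ A.E, e.q1 = v₁.1 ∧ e.top = v₁.2 ∧ e.q2 = v₂.1 ∧ e.com = Com.push v₂.2 ∧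
    x = ((A.w e : ℝ) : EReal))

/-- The summary graph `Gr(A)` has a positive simple cycle: a simple cycle containing
an `ω`-edge or whose total weight is positive. -/
def WPS.PosSimpleCycle (A : WPS Q Γ) : Prop :=
  ∃ (k : ℕ) (v : Fin (k + 1) → Q × Γ) (x : Fin (k + 1) → EReal),
    Function.Injective v ∧ (∀ i, A.GrEdge (v i) (v (i + 1)) (x i)) ∧
    ((∃ i, x i = ⊤) ∨ (0 : EReal) < ∑ i, x i)

/-- Weight of a finite path under the shifted weight function `w + r`. -/
def WPS.wtQ (A : WPS Q Γ) (r : ℚ) (es : List (Edge Q Γ)) : ℚ :=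
  (es.map (fun e => (A.w e : ℚ) + r)).sum

/-- The shifted system `A^r` (weight function `w + r`) has a good cycle. -/
def WPS.GoodCycleShift (A : WPS Q Γ) (r : ℚ) : Prop :=
  ∃ c es, IsConfig c ∧ A.Valid c es ∧ 0 < A.wtQ r es ∧ FirstMin c es ∧
    (endc c es).2 = c.2 ∧ (endc c es).1.head? = c.1.head?

end PDS

namespace PDS

variable {Q Γ : Type}

lemma valid_append (A : WPS Q Γ) (c : Config Q Γ) (l₁ l₂ : List (Edge Q Γ)) :
    A.Valid c (l₁ ++ l₂) ↔ A.Valid c l₁ ∧ A.Valid (endc c l₁) l₂ := by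
  induction l₁ generalizing c with
  | nil => simp [WPS.Valid, endc]
  | cons e l ih => simp [WPS.Valid, endc, ih, and_assoc]

lemma endc_append (c : Config Q Γ) (l₁ l₂ : List (Edge Q Γ)) :
    endc c (l₁ ++ l₂) = endc (endc c l₁) l₂ := by
  simp [endc]

lemma wt_append (A : WPS Q Γ) (l₁ l₂ : List (Edge Q Γ)) :
    A.wt (l₁ ++ l₂) = A.wt l₁ + A.wt l₂ := by
  simp [WPS.wt]

/-- Every stack string along the finite path `(c, es)` extends `α`. -/
def Above (α : List Γ) (c : Config Q Γ) (es : List (Edge Q Γ)) : Prop :=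
  ∀ c' ∈ trace c es, α <:+ c'.1

lemma above_nil (α : List Γ) (c : Config Q Γ) : Above α c [] ↔ α <:+ c.1 := by
  simp [Above, trace]

lemma above_cons (α : List Γ) (c : Config Q Γ) (e : Edge Q Γ) (es : List (Edge Q Γ)) :
    Above α c (e :: es) ↔ α <:+ c.1 ∧ Above α (next c e) es := by
  simp [Above, trace, List.scanl_cons]

lemma Above.head {α : List Γ} {c : Config Q Γ} {es : List (Edge Q Γ)}
    (h : Above α c es) : α <:+ c.1 := by
  cases es with
  | nil => exact (above_nil α c).1 h
  | cons e es => exact ((above_cons α c e es).1 h).1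

lemma Above.mono {α β : List Γ} {c : Config Q Γ} {es : List (Edge Q Γ)}
    (h : Above α c es) (hβ : β <:+ α) : Above β c es :=
  fun c' hc' => hβ.trans (h c' hc')

lemma above_append (α : List Γ) (c : Config Q Γ) (l₁ l₂ : List (Edge Q Γ)) :
    Above α c (l₁ ++ l₂) ↔ Above α c l₁ ∧ Above α (endc c l₁) l₂ := by
  induction l₁ generalizing c with
  | nil =>
    simp only [List.nil_append, above_nil, endc, List.foldl_nil]
    exact ⟨fun h => ⟨h.head, h⟩, fun h => h.2⟩
  | cons e l ih => simp [above_cons, endc, ih, and_assoc]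

/-- A path that never goes below the stack `γ :: a` can be replayed above `γ :: b`. -/
lemma replay (A : WPS Q Γ) (γ : Γ) (a b : List Γ) (es : List (Edge Q Γ)) :
    ∀ (s : List Γ) (q : Q), A.Valid (s ++ γ :: a, q) es →
      Above (γ :: a) (s ++ γ :: a, q) es →
      ∃ s' q', endc (s ++ γ :: a, q) es = (s' ++ γ :: a, q') ∧
        endc (s ++ γ :: b, q) es = (s' ++ γ :: b, q') ∧
        A.Valid (s ++ γ :: b, q) es ∧ Above (γ :: b) (s ++ γ :: b, q) es := by
  induction es with
  | nil =>
    intro s q _ _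
    exact ⟨s, q, rfl, rfl, trivial, (above_nil _ _).2 ⟨s, rfl⟩⟩
  | cons e es ih =>
    intro s q hv ha
    obtain ⟨⟨heE, hq, ht⟩, hv⟩ := hv
    obtain ⟨-, ha⟩ := (above_cons _ _ _ _).1 ha
    have hen : A.Enabled (s ++ γ :: b, q) e := by
      refine ⟨heE, hq, ?_⟩
      cases s <;> simpa using ht
    obtain ⟨s₁, h₁, h₂⟩ : ∃ s₁, next (s ++ γ :: a, q) e = (s₁ ++ γ :: a, e.q2) ∧
        next (s ++ γ :: b, q) e = (s₁ ++ γ :: b, e.q2) := by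
      rcases hcom : e.com with _ | _ | z
      · exact ⟨s, by simp [next, hcom, Com.apply], by simp [next, hcom, Com.apply]⟩
      · cases s with
        | nil =>
          have := ha.head.length_le
          simp [next, hcom, Com.apply] at this
        | cons x t => exact ⟨t, by simp [next, hcom, Com.apply], by simp [next, hcom, Com.apply]⟩
      · exact ⟨z :: s, by simp [next, hcom, Com.apply], by simp [next, hcom, Com.apply]⟩
    rw [h₁] at hv ha
    obtain ⟨s', q', e₁, e₂, hv', ha'⟩ := ih s₁ e.q2 hv ha
    refine ⟨s', q', ?_, ?_, ⟨hen, h₂ ▸ hv'⟩, (above_cons _ _ _ _).2 ⟨⟨s, rfl⟩, h₂ ▸ ha'⟩⟩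
    · rw [← e₁, ← h₁]; rfl
    · rw [← e₂, ← h₂]; rfl

/-- The edges `f i, …, f (i + k - 1)`. -/
def seg (f : ℕ → Edge Q Γ) (i k : ℕ) : List (Edge Q Γ) := (List.range' i k).map f

lemma seg_zero (f : ℕ → Edge Q Γ) (i : ℕ) : seg f i 0 = [] := rfl

lemma seg_succ (f : ℕ → Edge Q Γ) (i k : ℕ) : seg f i (k + 1) = f i :: seg f (i + 1) k := by
  simp [seg, List.range'_succ]

lemma endc_seg (c : Config Q Γ) (f : ℕ → Edge Q Γ) (i k : ℕ) :
    endc (confs c f i) (seg f i k) = confs c f (i + k) := by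
  induction k generalizing i with
  | zero => rfl
  | succ k ih =>
    rw [seg_succ, show i + (k + 1) = i + 1 + k by ring, ← ih]
    rfl

lemma valid_seg_iff (A : WPS Q Γ) (c : Config Q Γ) (f : ℕ → Edge Q Γ) (i k : ℕ) :
    A.Valid (confs c f i) (seg f i k) ↔
      ∀ j, i ≤ j → j < i + k → A.Enabled (confs c f j) (f j) := by
  induction k generalizing i with
  | zero => simp only [seg_zero, WPS.Valid, true_iff]; intro j; omega
  | succ k ih =>
    rw [seg_succ]
    change _ ∧ A.Valid (confs c f (i + 1)) _ ↔ _
    rw [ih]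
    constructor
    · rintro ⟨h₀, h⟩ j h₁ h₂
      rcases h₁.eq_or_lt with rfl | h₁
      · exact h₀
      · exact h j h₁ (by omega)
    · intro h
      exact ⟨h i le_rfl (by omega), fun j h₁ h₂ => h j (by omega) (by omega)⟩

lemma above_seg_iff (α : List Γ) (c : Config Q Γ) (f : ℕ → Edge Q Γ) (i k : ℕ) :
    Above α (confs c f i) (seg f i k) ↔
      ∀ j, i ≤ j → j ≤ i + k → α <:+ (confs c f j).1 := by
  induction k generalizing i with
  | zero =>
    rw [seg_zero, above_nil]
    exact ⟨fun h j h₁ h₂ => (show i = j by omega) ▸ h, fun h => h i le_rfl le_rfl⟩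
  | succ k ih =>
    rw [seg_succ, above_cons]
    change _ ∧ Above α (confs c f (i + 1)) _ ↔ _
    rw [ih]
    constructor
    · rintro ⟨h₀, h⟩ j h₁ h₂
      rcases h₁.eq_or_lt with rfl | h₁
      · exact h₀
      · exact h j h₁ (by omega)
    · intro h
      exact ⟨h i le_rfl (by omega), fun j h₁ h₂ => h j (by omega) (by omega)⟩

/-- Weight of the prefix of length `n` of an infinite path. -/
def prefixWt (A : WPS Q Γ) (f : ℕ → Edge Q Γ) (n : ℕ) : ℤ := ∑ i ∈ Finset.range n, A.w (f i)

lemma prefixWt_succ (A : WPS Q Γ) (f : ℕ → Edge Q Γ) (n : ℕ) :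
    prefixWt A f (n + 1) = prefixWt A f n + A.w (f n) := Finset.sum_range_succ _ _

lemma wt_seg (A : WPS Q Γ) (f : ℕ → Edge Q Γ) (i k : ℕ) :
    A.wt (seg f i k) = prefixWt A f (i + k) - prefixWt A f i := by
  induction k generalizing i with
  | zero => simp [seg_zero, WPS.wt]
  | succ k ih =>
    have h := ih (i + 1)
    rw [seg_succ, show i + (k + 1) = i + 1 + k by ring]
    rw [prefixWt_succ] at h
    simp only [WPS.wt, List.map_cons, List.sum_cons] at h ⊢
    rw [h]
    ring

lemma avgPref_eq (A : WPS Q Γ) (f : ℕ → Edge Q Γ) (n : ℕ) :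
    avgPref A f n = (prefixWt A f (n + 1) : ℝ) / (n + 1) := by
  simp [avgPref, prefixWt]

lemma suffix_next {α : List Γ} {c : Config Q Γ} (e : Edge Q Γ) (h : α <:+ c.1)
    (hl : α.length ≤ (next c e).1.length) : α <:+ (next c e).1 := by
  rcases hcom : e.com with _ | _ | z
  · simpa [next, hcom, Com.apply] using h
  · simp only [next, hcom, Com.apply] at hl ⊢
    obtain ⟨t, ht⟩ := h
    rw [← ht] at hl ⊢
    cases t with
    | nil =>
      have : α.length = 0 := by
        simp only [List.nil_append, List.length_tail] at hl
        omega
      simp [List.length_eq_zero_iff.1 this]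
    | cons x t => exact ⟨t, rfl⟩
  · simp only [next, hcom, Com.apply]
    exact h.trans (List.suffix_cons _ _)

/-- Time `i` is a local minimum of the portion of the path up to time `n`. -/
def MinUpTo (c : Config Q Γ) (f : ℕ → Edge Q Γ) (i n : ℕ) : Prop :=
  ∀ k, i ≤ k → k ≤ n → (confs c f i).1 <:+ (confs c f k).1

lemma MinUpTo.mono {c : Config Q Γ} {f : ℕ → Edge Q Γ} {i n n' : ℕ} (h : MinUpTo c f i n)
    (hn : n' ≤ n) : MinUpTo c f i n' :=
  fun k h₁ h₂ => h k h₁ (h₂.trans hn)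

/-- The state and the top stack symbol at time `i`. -/
def mode (c : Config Q Γ) (f : ℕ → Edge Q Γ) (i : ℕ) : Q × Option Γ :=
  ((confs c f i).2, (confs c f i).1.head?)

lemma exists_forall_minUpTo (c : Config Q Γ) (f : ℕ → Edge Q Γ) (t : ℕ) :
    ∃ m ≥ t, ∀ n, MinUpTo c f m n := by
  obtain ⟨m, hm, hmin⟩ := exists_minimalFor_of_wellFoundedLT (fun m => t ≤ m)
    (fun m => (confs c f m).1.length) ⟨t, le_rfl⟩
  refine ⟨m, hm, fun n k hk _ => ?_⟩
  induction k, hk using Nat.le_induction with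
  | base => exact List.suffix_refl _
  | succ k hk ih =>
    refine suffix_next _ (ih (by omega)) ?_
    by_contra hlt
    exact hlt (hmin (j := k + 1) (by simp only; omega) (le_of_not_ge hlt))

lemma exists_recurrent_mode [Finite Q] [Finite Γ] (c : Config Q Γ) (f : ℕ → Edge Q Γ) :
    ∃ m, (∀ n, MinUpTo c f m n) ∧
      ∀ t, ∃ m' ≥ t, mode c f m' = mode c f m := by
  by_contra! hcon
  choose g hg using fun v : Q × Option Γ =>
    show ∃ t, ∀ m ≥ t, (∀ n, MinUpTo c f m n) → mode c f m ≠ v by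
      by_cases hv : ∃ m, (∀ n, MinUpTo c f m n) ∧ mode c f m = v
      · obtain ⟨m, hm, rfl⟩ := hv
        obtain ⟨t, ht⟩ := hcon m hm
        exact ⟨t, fun m' h _ => ht m' h⟩
      · push Not at hv
        exact ⟨0, fun m _ h => hv m h⟩
  obtain ⟨T, hT⟩ := (Set.finite_range g).bddAbove
  obtain ⟨m, hm, hmin⟩ := exists_forall_minUpTo c f T
  exact hg _ m ((hT ⟨_, rfl⟩).trans hm) hmin rfl

lemma minUpTo_succ_of_no_return {c : Config Q Γ} {f : ℕ → Edge Q Γ}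
    {j n : ℕ} (hj : MinUpTo c f j n)
    (hr : ∀ k, j < k → k ≤ n → (confs c f k).1 ≠ (confs c f j).1) :
    MinUpTo c f (j + 1) n := by
  have hlen : ∀ k, j < k → k ≤ n → (confs c f j).1.length + 1 ≤ (confs c f k).1.length := by
    intro k h₁ h₂
    have hs := hj k h₁.le h₂
    refine Nat.lt_of_le_of_ne hs.length_le fun h => hr k h₁ h₂ (hs.eq_of_length h).symm
  have hle : (confs c f (j + 1)).1.length ≤ (confs c f j).1.length + 1 := by
    change (next (confs c f j) (f j)).1.length ≤ _
    rcases hcom : (f j).com with _ | _ | z <;> simp [next, hcom, Com.apply]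
    omega
  intro k h₁ h₂
  induction k, h₁ using Nat.le_induction with
  | base => exact List.suffix_refl _
  | succ k hk ih =>
    exact suffix_next _ (ih (by omega)) (hle.trans (hlen (k + 1) (by omega) h₂))

lemma prefixWt_le_of_mode_subset {A : WPS Q Γ} {c : Config Q Γ} {f : ℕ → Edge Q Γ}
    {m : ℕ} {M : ℤ} (hM : 0 ≤ M)
    (hw : ∀ e, A.w e ≤ M)
    (hcycle : ∀ i j, m ≤ i → i ≤ j → MinUpTo c f i j → mode c f i = mode c f j →
      prefixWt A f j ≤ prefixWt A f i)
    (hsum : ∀ i j, m ≤ i → i ≤ j → MinUpTo c f i j → (confs c f i).1 = (confs c f j).1 →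
      prefixWt A f j ≤ prefixWt A f i + M)
    (n : ℕ) (S : Finset (Q × Option Γ)) :
    ∀ i, m ≤ i → i ≤ n → MinUpTo c f i n →
      (∀ k, i ≤ k → k ≤ n → MinUpTo c f k n → mode c f k ∈ S) →
      prefixWt A f n ≤ prefixWt A f i + S.card * M := by
  classical
  induction S using Finset.strongInduction with
  | H S ih =>
  intro i hmi hin hi hS
  obtain ⟨j, ⟨hij, hjn, hj, hji⟩, hlast⟩ :
      ∃ j, (i ≤ j ∧ j ≤ n ∧ MinUpTo c f j n ∧ mode c f j = mode c f i) ∧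
        ∀ k, j < k → k ≤ n → MinUpTo c f k n → mode c f k ≠ mode c f i := by
    let P : ℕ → Prop := fun j => i ≤ j ∧ j ≤ n ∧ MinUpTo c f j n ∧ mode c f j = mode c f i
    have hP : P (Nat.findGreatest P n) :=
      Nat.findGreatest_spec (P := P) hin ⟨le_rfl, hin, hi, rfl⟩
    refine ⟨_, hP, fun k h₁ h₂ h₃ h₄ => ?_⟩
    exact Nat.findGreatest_is_greatest h₁ h₂ ⟨hP.1.trans h₁.le, h₂, h₃, h₄⟩
  have h₁ := hcycle i j hmi hij (hi.mono hjn) hji.symm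
  have hiS : mode c f i ∈ S := hS i le_rfl hin hi
  rcases hjn.eq_or_lt with rfl | hjn
  · have : 0 ≤ (S.card : ℤ) * M := by positivity
    linarith
  obtain ⟨k, hjk, hkn, hk, hwk⟩ : ∃ k, j < k ∧ k ≤ n ∧ MinUpTo c f k n ∧
      prefixWt A f k ≤ prefixWt A f j + M := by
    by_cases hr : ∃ k, j < k ∧ k ≤ n ∧ (confs c f k).1 = (confs c f j).1
    · obtain ⟨k, hjk, hkn, hk⟩ := hr
      refine ⟨k, hjk, hkn, fun l h₁ h₂ => ?_,
        hsum j k (hmi.trans hij) hjk.le (hj.mono hkn) hk.symm⟩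
      rw [hk]
      exact hj l (hjk.le.trans h₁) h₂
    · push Not at hr
      refine ⟨j + 1, by omega, hjn, minUpTo_succ_of_no_return hj hr, ?_⟩
      rw [prefixWt_succ]
      linarith [hw (f j)]
  have h₂ := ih (S.erase (mode c f i)) (Finset.erase_ssubset hiS) k (by omega) hkn hk
    fun l h₁ h₂ h₃ => Finset.mem_erase.2
      ⟨hlast l (by omega) h₂ h₃, hS l (by omega) h₂ h₃⟩
  have hcard : (S.card : ℤ) = (S.erase (mode c f i)).card + 1 := by
    exact_mod_cast (Finset.card_erase_add_one hiS).symm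
  rw [hcard]
  linarith

/-- Some finite path from the initial configuration contains a good cycle. -/
def ReachesGoodCycle (A : WPS Q Γ) : Prop :=
  ∃ es : List (Edge Q Γ), A.Valid A.start es ∧ ContainsGoodCycle A A.start es

lemma reachesGoodCycle_of_confs {A : WPS Q Γ} {f : ℕ → Edge Q Γ} (hf : A.ValidInf A.start f)
    (i : ℕ) (es : List (Edge Q Γ)) (h : A.GoodCycle (confs A.start f i) es) :
    ReachesGoodCycle A := by
  have he : endc A.start (seg f 0 i) = confs A.start f i := by
    simpa [confs] using endc_seg A.start f 0 i
  refine ⟨seg f 0 i ++ es, ?_, _, _, rfl, he ▸ h⟩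
  rw [valid_append, he]
  exact ⟨(valid_seg_iff A A.start f 0 i).2 fun j _ _ => hf j, h.1⟩

lemma prefixWt_le_of_mode_eq {A : WPS Q Γ} (hA : ¬ ReachesGoodCycle A) {f : ℕ → Edge Q Γ}
    (hf : A.ValidInf A.start f) {i j : ℕ} (hij : i ≤ j) (hmin : MinUpTo A.start f i j)
    (hmode : mode A.start f i = mode A.start f j) : prefixWt A f j ≤ prefixWt A f i := by
  obtain ⟨k, rfl⟩ := Nat.exists_eq_add_of_le hij
  by_contra! hlt
  refine hA (reachesGoodCycle_of_confs hf i (seg f i k) ⟨?_, ?_, ?_, ?_⟩)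
  · exact (valid_seg_iff A A.start f i k).2 fun l _ _ => hf l
  · rw [wt_seg]
    linarith
  · exact (above_seg_iff _ A.start f i k).2 hmin
  · rw [endc_seg]
    simp only [mode, Prod.mk.injEq] at hmode
    exact ⟨hmode.1.symm, hmode.2.symm⟩

/-- Replacing one balanced segment inside a recurring cycle by another balanced segment with the
same end modes bounds the weight of the latter. -/
lemma exists_bound_of_segment {A : WPS Q Γ} (hA : ¬ ReachesGoodCycle A) {f : ℕ → Edge Q Γ}
    (hf : A.ValidInf A.start f) {m : ℕ} (hm : ∀ n, MinUpTo A.start f m n)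
    (hrec : ∀ t, ∃ m' ≥ t, mode A.start f m' = mode A.start f m)
    {i j : ℕ} (hmi : m ≤ i) (hij : i ≤ j)
    (hst : (confs A.start f i).1 = (confs A.start f j).1) :
    ∃ B : ℤ, ∀ i' j', i' ≤ j' → MinUpTo A.start f i' j' →
      (confs A.start f i').1 = (confs A.start f j').1 →
      mode A.start f i' = mode A.start f i → mode A.start f j' = mode A.start f j →
      prefixWt A f j' ≤ prefixWt A f i' + B := by
  obtain ⟨m', hjm', hm'⟩ := hrec j
  obtain ⟨a, rfl⟩ := Nat.exists_eq_add_of_le hmi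
  obtain ⟨d, rfl⟩ := Nat.exists_eq_add_of_le hjm'
  refine ⟨prefixWt A f m - prefixWt A f (m + a) + prefixWt A f j - prefixWt A f (j + d), ?_⟩
  intro i' j' hij' hmin' hst' hmi' hmj'
  obtain ⟨k, rfl⟩ := Nat.exists_eq_add_of_le hij'
  by_contra! hlt
  simp only [mode, Prod.mk.injEq] at hmi' hmj' hm'
  obtain ⟨γ, x, hx⟩ : ∃ γ x, (confs A.start f i').1 = γ :: x := by
    have := (hf i').2.2
    cases h : (confs A.start f i').1 with
    | nil => simp [h] at this
    | cons γ x => exact ⟨γ, x, rfl⟩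
  obtain ⟨y, hy⟩ : ∃ y, (confs A.start f (m + a)).1 = γ :: y := by
    have := hmi'.2
    rw [hx] at this
    cases h : (confs A.start f (m + a)).1 with
    | nil => simp [h] at this
    | cons γ' y =>
      simp only [h, List.head?_cons, Option.some.injEq] at this
      exact ⟨y, by rw [this]⟩
  have hci' : confs A.start f i' = (γ :: x, (confs A.start f (m + a)).2) :=
    Prod.ext hx hmi'.1
  have hci : confs A.start f (m + a) = (γ :: y, (confs A.start f (m + a)).2) :=
    Prod.ext hy rfl
  have hv := (valid_seg_iff A A.start f i' k).2 fun l _ _ => hf l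
  have hab := (above_seg_iff _ A.start f i' k).2 hmin'
  rw [hx] at hab
  rw [hci'] at hv hab
  obtain ⟨s, q, e₁, e₂, hv', hab'⟩ := replay A γ x y (seg f i' k) [] _ hv hab
  simp only [List.nil_append] at e₁ e₂ hv' hab'
  rw [← hci', endc_seg] at e₁
  have hs : s = [] := by
    have := congrArg Prod.fst e₁
    rw [← hst', hx] at this
    simpa using this
  subst hs
  rw [← hci] at e₂ hv' hab'
  have hend : endc (confs A.start f (m + a)) (seg f i' k) = confs A.start f j := by
    rw [e₂]
    refine Prod.ext ?_ ?_
    · rw [← hst, hy]; rfl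
    · rw [← hmj'.1, e₁]
  refine hA (reachesGoodCycle_of_confs hf m (seg f m a ++ seg f i' k ++ seg f j d)
    ⟨?_, ?_, ?_, ?_⟩)
  · rw [valid_append, valid_append, endc_append, endc_seg, hend]
    exact ⟨⟨(valid_seg_iff A A.start f m a).2 fun l _ _ => hf l, hv'⟩,
      (valid_seg_iff A A.start f j d).2 fun l _ _ => hf l⟩
  · rw [wt_append, wt_append, wt_seg, wt_seg, wt_seg]
    linarith
  · change Above _ _ _
    rw [above_append, above_append, endc_append, endc_seg, hend]
    refine ⟨⟨(above_seg_iff _ A.start f m a).2 (hm _), hab'.mono ?_⟩,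
      (above_seg_iff _ A.start f j d).2 fun l h₁ _ => hm l l (by omega) le_rfl⟩
    rw [← hy]
    exact hm (m + a) (m + a) (by omega) le_rfl
  · rw [endc_append, endc_append, endc_seg, hend, endc_seg]
    exact hm'

lemma exists_bound_of_balanced [Finite Q] [Finite Γ] {A : WPS Q Γ} (hA : ¬ ReachesGoodCycle A)
    {f : ℕ → Edge Q Γ} (hf : A.ValidInf A.start f) {m : ℕ} (hm : ∀ n, MinUpTo A.start f m n)
    (hrec : ∀ t, ∃ m' ≥ t, mode A.start f m' = mode A.start f m) :
    ∃ B : ℤ, ∀ i j, m ≤ i → i ≤ j → MinUpTo A.start f i j →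
      (confs A.start f i).1 = (confs A.start f j).1 →
      prefixWt A f j ≤ prefixWt A f i + B := by
  choose B hB using fun v : (Q × Option Γ) × (Q × Option Γ) =>
    show ∃ B : ℤ, ∀ i j, m ≤ i → i ≤ j → MinUpTo A.start f i j →
        (confs A.start f i).1 = (confs A.start f j).1 →
        mode A.start f i = v.1 → mode A.start f j = v.2 →
        prefixWt A f j ≤ prefixWt A f i + B by
      by_cases hv : ∃ i j, m ≤ i ∧ i ≤ j ∧ (confs A.start f i).1 = (confs A.start f j).1 ∧
          mode A.start f i = v.1 ∧ mode A.start f j = v.2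
      · obtain ⟨i, j, hmi, hij, hst, h₁, h₂⟩ := hv
        obtain ⟨B, hB⟩ := exists_bound_of_segment hA hf hm hrec hmi hij hst
        exact ⟨B, fun i' j' _ hij' hmin' hst' h₁' h₂' =>
          hB i' j' hij' hmin' hst' (h₁'.trans h₁.symm) (h₂'.trans h₂.symm)⟩
      · push Not at hv
        exact ⟨0, fun i j hmi hij _ hst h₁ h₂ => absurd h₂ (hv i j hmi hij hst h₁)⟩
  obtain ⟨M, hM⟩ := (Set.finite_range B).bddAbove
  refine ⟨M, fun i j hmi hij hmin hst => ?_⟩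
  have h₁ := hB (mode A.start f i, mode A.start f j) i j hmi hij hmin hst rfl rfl
  have h₂ : B (mode A.start f i, mode A.start f j) ≤ M := hM ⟨_, rfl⟩
  linarith

instance [Finite Γ] : Finite (Com Γ) := by
  refine Finite.of_surjective
    (fun o : Option (Option Γ) => match o with
      | none => Com.skip
      | some none => Com.pop
      | some (some z) => Com.push z) ?_
  rintro (_ | _ | z)
  exacts [⟨none, rfl⟩, ⟨some none, rfl⟩, ⟨some (some z), rfl⟩]

instance [Finite Q] [Finite Γ] : Finite (Edge Q Γ) := by
  refine Finite.of_surjective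
    (fun x : Q × Γ × Q × Com Γ => (⟨x.1, x.2.1, x.2.2.1, x.2.2.2⟩ : Edge Q Γ)) ?_
  rintro ⟨q, γ, q', z⟩
  exact ⟨(q, γ, q', z), rfl⟩

lemma exists_abs_weight_le [Finite Q] [Finite Γ] (A : WPS Q Γ) :
    ∃ M : ℤ, 0 ≤ M ∧ ∀ e, |A.w e| ≤ M := by
  obtain ⟨M, hM⟩ := (Set.finite_range fun e => |A.w e|).bddAbove
  exact ⟨max M 0, le_max_right _ _, fun e => (hM ⟨e, rfl⟩).trans (le_max_left _ _)⟩

lemma exists_prefixWt_le [Finite Q] [Finite Γ] {A : WPS Q Γ} (hA : ¬ ReachesGoodCycle A)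
    {f : ℕ → Edge Q Γ} (hf : A.ValidInf A.start f) :
    ∃ (m : ℕ) (C : ℤ), ∀ n ≥ m, prefixWt A f n ≤ C := by
  obtain ⟨m, hm, hrec⟩ := exists_recurrent_mode A.start f
  obtain ⟨B, hB⟩ := exists_bound_of_balanced hA hf hm hrec
  obtain ⟨W, hW, hw⟩ := exists_abs_weight_le A
  have := Fintype.ofFinite (Q × Option Γ)
  refine ⟨m, prefixWt A f m + (Finset.univ : Finset (Q × Option Γ)).card * max W B,
    fun n hn => ?_⟩
  refine prefixWt_le_of_mode_subset (hW.trans (le_max_left _ _))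
    (fun e => ((le_abs_self _).trans (hw e)).trans (le_max_left _ _))
    (fun i j _ hij hmin hmode => prefixWt_le_of_mode_eq hA hf hij hmin hmode)
    (fun i j hmi hij hmin hst => (hB i j hmi hij hmin hst).trans (by gcongr; exact le_max_right _ _))
    n Finset.univ m le_rfl hn (hm n) fun _ _ _ _ => Finset.mem_univ _

lemma exists_abs_avgPref_le [Finite Q] [Finite Γ] (A : WPS Q Γ) (f : ℕ → Edge Q Γ) :
    ∃ M : ℝ, ∀ n, |avgPref A f n| ≤ M := by
  obtain ⟨M, -, hM⟩ := exists_abs_weight_le A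
  refine ⟨M, fun n => ?_⟩
  have hn : (0 : ℝ) < n + 1 := by positivity
  rw [avgPref, abs_div, abs_of_pos hn, div_le_iff₀ hn]
  calc |∑ i ∈ Finset.range (n + 1), (A.w (f i) : ℝ)|
      ≤ ∑ i ∈ Finset.range (n + 1), |(A.w (f i) : ℝ)| := Finset.abs_sum_le_sum_abs _ _
    _ ≤ ∑ _i ∈ Finset.range (n + 1), (M : ℝ) :=
        Finset.sum_le_sum fun i _ => by exact_mod_cast hM (f i)
    _ = M * (n + 1) := by simp [mul_comm]

section Bounded

open Filter

variable [Finite Q] [Finite Γ] (A : WPS Q Γ) (f : ℕ → Edge Q Γ)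

lemma isBoundedUnder_le_avgPref : IsBoundedUnder (· ≤ ·) atTop (avgPref A f) := by
  obtain ⟨M, hM⟩ := exists_abs_avgPref_le A f
  exact isBoundedUnder_of ⟨M, fun n => (abs_le.1 (hM n)).2⟩

lemma isBoundedUnder_ge_avgPref : IsBoundedUnder (· ≥ ·) atTop (avgPref A f) := by
  obtain ⟨M, hM⟩ := exists_abs_avgPref_le A f
  exact isBoundedUnder_of ⟨-M, fun n => (abs_le.1 (hM n)).1⟩

lemma limInfAvg_le_limSupAvg : LimInfAvg A f ≤ LimSupAvg A f :=
  liminf_le_limsup (isBoundedUnder_le_avgPref A f) (isBoundedUnder_ge_avgPref A f)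

variable {A f}

lemma limSupAvg_nonpos {m : ℕ} {C : ℤ} (h : ∀ n ≥ m, prefixWt A f n ≤ C) :
    LimSupAvg A f ≤ 0 := by
  have hlim : Tendsto (fun n : ℕ => (C : ℝ) / (n + 1)) atTop (nhds 0) :=
    tendsto_const_nhds.div_atTop (tendsto_natCast_atTop_atTop.atTop_add tendsto_const_nhds)
  rw [← hlim.limsup_eq]
  refine limsup_le_limsup ?_ (isBoundedUnder_ge_avgPref A f).isCoboundedUnder_le
    hlim.isBoundedUnder_le
  filter_upwards [eventually_ge_atTop m] with n hn
  rw [avgPref_eq]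
  gcongr
  exact_mod_cast h (n + 1) (by omega)

lemma limInfAvg_pos {N p : ℕ} (hp : 0 < p)
    (h : ∀ n ≥ N, prefixWt A f n + 1 ≤ prefixWt A f (n + p)) : 0 < LimInfAvg A f := by
  obtain ⟨C, hC⟩ : ∃ C : ℤ, ∀ n < N + p, (n : ℤ) - C ≤ p * prefixWt A f n := by
    obtain ⟨C, hC⟩ := ((Set.finite_Iio (N + p)).image
      fun n : ℕ => (n : ℤ) - p * prefixWt A f n).bddAbove
    exact ⟨C, fun n hn => by linarith [hC ⟨n, hn, rfl⟩]⟩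
  have hlin : ∀ n : ℕ, (n : ℤ) - C ≤ p * prefixWt A f n := by
    intro n
    induction n using Nat.strong_induction_on with
    | _ n ih =>
    rcases lt_or_ge n (N + p) with hn | hn
    · exact hC n hn
    · obtain ⟨k, rfl⟩ := Nat.exists_eq_add_of_le' (show p ≤ n by omega)
      have h₁ := ih k (by omega)
      have h₂ := mul_le_mul_of_nonneg_left (h k (by omega)) (show (0 : ℤ) ≤ p by positivity)
      push_cast
      linarith
  have hp' : (0 : ℝ) < p := by exact_mod_cast hp
  have hε : (0 : ℝ) < 1 / (2 * p) := by positivity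
  refine hε.trans_le (le_liminf_of_le (isBoundedUnder_le_avgPref A f).isCoboundedUnder_ge ?_)
  filter_upwards [eventually_ge_atTop (2 * C).toNat] with n hn
  have h₁ : (2 * C : ℝ) ≤ n := by
    have : 2 * C ≤ n := by omega
    exact_mod_cast this
  have h₂ : ((n + 1 : ℕ) : ℝ) - C ≤ p * prefixWt A f (n + 1) := by exact_mod_cast hlin (n + 1)
  push_cast at h₂
  rw [avgPref_eq, div_le_div_iff₀ (by positivity) (by positivity)]
  linarith

end Bounded

lemma seg_eq_of_getElem {f : ℕ → Edge Q Γ} {i : ℕ} {es : List (Edge Q Γ)}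
    (h : ∀ (j : ℕ) (hj : j < es.length), f (i + j) = es[j]) : seg f i es.length = es := by
  refine List.ext_getElem (by simp [seg]) fun j h₁ h₂ => ?_
  simp [seg, h j h₂]

lemma exists_validInf_of_reachesGoodCycle {A : WPS Q Γ} (h : ReachesGoodCycle A) :
    ∃ f, A.ValidInf A.start f ∧ ∃ N p : ℕ, 0 < p ∧
      ∀ n ≥ N, prefixWt A f n + 1 ≤ prefixWt A f (n + p) := by
  obtain ⟨_, hval, es₀, es, rfl, hv, hwt, hmin, hq, htop⟩ := h
  have hv₀ := ((valid_append A _ _ _).1 hval).1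
  have hne : es ≠ [] := by
    rintro rfl
    simp [WPS.wt] at hwt
  have hp : 0 < es.length := List.length_pos_iff.2 hne
  set N := es₀.length with hN
  set p := es.length with hpdef
  obtain ⟨γ, a, q, hc⟩ : ∃ γ a q, endc A.start es₀ = (γ :: a, q) := by
    rcases hs : endc A.start es₀ with ⟨_ | ⟨γ, a⟩, q⟩
    · obtain ⟨e, l, rfl⟩ := List.exists_cons_of_ne_nil hne
      have := hv.1.2.2
      simp [hs] at this
    · exact ⟨γ, a, q, rfl⟩
  rw [hc] at hv hmin hq htop
  have hloop : ∀ b, A.Valid (γ :: b, q) es ∧ ∃ b', endc (γ :: b, q) es = (γ :: b', q) := by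
    intro b
    obtain ⟨s, q', e₁, e₂, hv', -⟩ := replay A γ a b es [] q hv hmin
    simp only [List.nil_append] at e₁ e₂ hv'
    refine ⟨hv', ?_⟩
    rw [e₁] at hq htop
    simp only at hq
    subst hq
    cases s with
    | nil => exact ⟨b, e₂⟩
    | cons x s =>
      simp only [List.cons_append, List.head?_cons, Option.some.injEq] at htop
      subst htop
      exact ⟨_, e₂⟩
  let f : ℕ → Edge Q Γ := fun n =>
    if hn : n < N then es₀[n] else es[(n - N) % p]'(Nat.mod_lt _ hp)
  have hseg₀ : seg f 0 N = es₀ := seg_eq_of_getElem fun j hj => by simp [f, hN, hj]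
  have hseg : ∀ k, seg f (N + k * p) p = es := fun k => seg_eq_of_getElem fun j hj => by
    have h₁ : (N + k * p + j - N) % p = j := by
      rw [show N + k * p + j - N = j + k * p by omega, Nat.add_mul_mod_self_right,
        Nat.mod_eq_of_lt hj]
    have h₂ : ¬ N + k * p + j < N := by omega
    simp only [f, h₂, dite_false, h₁]
  have hconf₀ : confs A.start f N = endc A.start es₀ := by
    have := endc_seg A.start f 0 N
    rw [hseg₀, zero_add] at this
    exact this.symm
  have hconf : ∀ k, ∃ b, confs A.start f (N + k * p) = (γ :: b, q) := by
    intro k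
    induction k with
    | zero => exact ⟨a, by rw [zero_mul, add_zero, hconf₀, hc]⟩
    | succ k ih =>
      obtain ⟨b, hb⟩ := ih
      obtain ⟨b', hb'⟩ := (hloop b).2
      refine ⟨b', ?_⟩
      rw [show N + (k + 1) * p = N + k * p + p by ring, ← endc_seg, hseg, hb, hb']
  refine ⟨f, fun n => ?_, N, p, hp, fun n hn => ?_⟩
  · rcases lt_or_ge n N with hn | hn
    · refine (valid_seg_iff A A.start f 0 N).1 ?_ n (by omega) (by omega)
      rw [hseg₀]
      exact hv₀
    · obtain ⟨b, hb⟩ := hconf ((n - N) / p)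
      have h₁ := Nat.div_add_mod (n - N) p
      have h₂ := Nat.mod_lt (n - N) hp
      rw [mul_comm] at h₁
      refine (valid_seg_iff A A.start f (N + (n - N) / p * p) p).1 ?_ n (by omega) (by omega)
      rw [hseg, hb]
      exact (hloop b).1
  · have hper : ∀ n ≥ N, f (n + p) = f n := by
      intro n hn
      have h₁ : ¬ n + p < N := by omega
      have h₂ : ¬ n < N := by omega
      have h₃ : (n + p - N) % p = (n - N) % p := by
        rw [show n + p - N = n - N + p by omega, Nat.add_mod_right]
      simp only [f, h₁, h₂, dite_false, h₃]
    induction n, hn using Nat.le_induction with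
    | base =>
      have := wt_seg A f N p
      have h₀ := hseg 0
      rw [zero_mul, add_zero] at h₀
      rw [h₀] at this
      linarith
    | succ n hn ih =>
      rw [show n + 1 + p = n + p + 1 by ring, prefixWt_succ, prefixWt_succ, hper n hn]
      linarith

end PDS

open PDS in
/-- equivalence of (i) existence of an infinite path from the initial
configuration with positive limsup-average, (ii) with positive liminf-average, and
(iii) existence of a finite valid path from the initial configuration containing a
good cycle. -/
theorem good_cycle_iff_positive_mean_payoff
    {Q Γ : Type} [Fintype Q] [Fintype Γ] (A : WPS Q Γ) :
    ((∃ f : ℕ → Edge Q Γ, A.ValidInf A.start f ∧ 0 < LimSupAvg A f) ↔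
      (∃ es : List (Edge Q Γ), A.Valid A.start es ∧ ContainsGoodCycle A A.start es)) ∧
    ((∃ f : ℕ → Edge Q Γ, A.ValidInf A.start f ∧ 0 < LimInfAvg A f) ↔
      (∃ es : List (Edge Q Γ), A.Valid A.start es ∧ ContainsGoodCycle A A.start es)) := by
  change (_ ↔ ReachesGoodCycle A) ∧ (_ ↔ ReachesGoodCycle A)
  have hsup : ∀ f, A.ValidInf A.start f → 0 < LimSupAvg A f → ReachesGoodCycle A := by
    intro f hf hpos
    by_contra hA
    obtain ⟨m, C, hC⟩ := exists_prefixWt_le hA hf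
    exact (limSupAvg_nonpos hC).not_gt hpos
  have hinf : ReachesGoodCycle A → ∃ f, A.ValidInf A.start f ∧ 0 < LimInfAvg A f := by
    intro h
    obtain ⟨f, hf, N, p, hp, hper⟩ := exists_validInf_of_reachesGoodCycle h
    exact ⟨f, hf, limInfAvg_pos hp hper⟩
  refine ⟨⟨fun ⟨f, hf, hpos⟩ => hsup f hf hpos, fun h => ?_⟩,
    ⟨fun ⟨f, hf, hpos⟩ => hsup f hf (hpos.trans_le (limInfAvg_le_limSupAvg A f)), hinf⟩⟩
  obtain ⟨f, hf, hpos⟩ := hinf h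
  exact ⟨f, hf, hpos.trans_le (limInfAvg_le_limSupAvg A f)⟩
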